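/- Let κ be a perfect kernel on X satisfying Frostman's maximum principle and the domination principle, let A ⊆ X satisfy cap_*(A) > 0 and E⁺(A) closed in (E⁺, d), let f := −U^ζ where ζ ∈ E⁺ and ζ(X) ≤ 1, and assume either cap_*(A) < ∞ or ζ^A(X) = 1, so that the solution λ_{A,f} exists. Set η_{A,f} := (1 − ζ^A(X))/cap_*(A) and Λ_{A,f} := { μ ∈ E⁺ : U_f^μ ≥ η_{A,f} n.e. on A }. Then λ_{A,f} ∈ Λ_{A,f} and λ_{A,f} is the measure of minimum potential in Λ_{A,f}: U^{λ_{A,f}}(x) ≤ U^μ(x) for every μ ∈ Λ_{A,f} and every x ∈ X; moreover λ_{A,f} is the unique element of Λ_{A,f} with this property. -/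

import Mathlib

open MeasureTheory Topology Filter Set ENNReal

noncomputable section

namespace GaussVar

variable {X : Type*} [TopologicalSpace X] [MeasurableSpace X]

/-- A (positive) Radon measure: a regular Borel measure. -/
def IsRadon (μ : Measure X) : Prop := μ.Regular

/-- The mutual energy `I(μ,ν) = ∬ κ(x,y) d(μ⊗ν)(x,y)`. -/
def mutualEnergy (κ : X → X → ℝ≥0∞) (μ ν : Measure X) : ℝ≥0∞ :=
  ∫⁻ p : X × X, κ p.1 p.2 ∂(μ.prod ν)

/-- The energy `I(μ) := I(μ,μ)`. -/
def energy (κ : X → X → ℝ≥0∞) (μ : Measure X) : ℝ≥0∞ := mutualEnergy κ μ μ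

/-- Membership in the cone `E⁺` of Radon measures with finite energy. -/
def memEplus (κ : X → X → ℝ≥0∞) (μ : Measure X) : Prop :=
  IsRadon μ ∧ energy κ μ < ⊤

/-- A kernel: symmetric and lower semicontinuous with values in `[0,∞]`. -/
def IsKernel (κ : X → X → ℝ≥0∞) : Prop :=
  (∀ x y, κ x y = κ y x) ∧ LowerSemicontinuous (fun p : X × X => κ p.1 p.2)

/-- The strong (energy) metric `d(μ,ν) := (I(μ)+I(ν)−2I(μ,ν))^{1/2}` on `E⁺`. -/
def strongDist (κ : X → X → ℝ≥0∞) (μ ν : Measure X) : ℝ :=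
  Real.sqrt ((energy κ μ).toReal + (energy κ ν).toReal - 2 * (mutualEnergy κ μ ν).toReal)

/-- The energy principle (strict positive definiteness). -/
def EnergyPrinciple (κ : X → X → ℝ≥0∞) : Prop :=
  ∀ μ ν : Measure X, memEplus κ μ → memEplus κ ν →
    2 * mutualEnergy κ μ ν ≤ energy κ μ + energy κ ν ∧
      (2 * mutualEnergy κ μ ν = energy κ μ + energy κ ν → μ = ν)

/-- Convergence of a sequence in the strong metric. -/
def StrongTendstoSeq (κ : X → X → ℝ≥0∞) (μ : ℕ → Measure X) (μ₀ : Measure X) : Prop :=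
  Tendsto (fun n => strongDist κ (μ n) μ₀) atTop (𝓝 0)

/-- Vague convergence of a sequence of measures. -/
def VagueTendstoSeq (μ : ℕ → Measure X) (μ₀ : Measure X) : Prop :=
  ∀ φ : X → ℝ, Continuous φ → HasCompactSupport φ →
    Tendsto (fun n => ∫ x, φ x ∂(μ n)) atTop (𝓝 (∫ x, φ x ∂μ₀))

/-- Cauchy sequence in the strong metric. -/
def StrongCauchySeq (κ : X → X → ℝ≥0∞) (μ : ℕ → Measure X) : Prop :=
  ∀ ε : ℝ, 0 < ε → ∃ N : ℕ, ∀ m ≥ N, ∀ n ≥ N, strongDist κ (μ m) (μ n) < ε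

/-- A perfect kernel: satisfies the energy principle, `(E⁺,d)` is complete, and
strong convergence implies vague convergence. -/
def IsPerfect (κ : X → X → ℝ≥0∞) : Prop :=
  EnergyPrinciple κ ∧
    (∀ μ : ℕ → Measure X, (∀ n, memEplus κ (μ n)) → StrongCauchySeq κ μ →
        ∃ μ₀ : Measure X, memEplus κ μ₀ ∧ StrongTendstoSeq κ μ μ₀) ∧
    (∀ (μ : ℕ → Measure X) (μ₀ : Measure X), (∀ n, memEplus κ (μ n)) → memEplus κ μ₀ →
        StrongTendstoSeq κ μ μ₀ → VagueTendstoSeq μ μ₀)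

/-- `μ` is concentrated on `A`: the complement of `A` is locally `μ`-negligible. -/
def Concentrated (μ : Measure X) (A : Set X) : Prop :=
  ∀ K : Set X, IsCompact K → μ (Aᶜ ∩ K) = 0

/-- Membership in `Ĕ⁺(A)`: finite-energy Radon measures concentrated on `A`
of unit total mass. -/
def memBreve (κ : X → X → ℝ≥0∞) (A : Set X) (μ : Measure X) : Prop :=
  memEplus κ μ ∧ Concentrated μ A ∧ μ Set.univ = 1

/-- `w(A) := inf { I(μ) : μ ∈ Ĕ⁺(A) }` (with `inf ∅ = ⊤`). -/
def wcap (κ : X → X → ℝ≥0∞) (A : Set X) : ℝ≥0∞ :=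
  ⨅ (μ : Measure X) (_ : memBreve κ A μ), energy κ μ

/-- The inner capacity `cap_*(A) := 1 / w(A)`. -/
def innerCap (κ : X → X → ℝ≥0∞) (A : Set X) : ℝ≥0∞ := (wcap κ A)⁻¹

/-- The outer capacity `cap^*(E) := inf { cap_*(D) : D open, E ⊆ D }`. -/
def outerCap (κ : X → X → ℝ≥0∞) (E : Set X) : ℝ≥0∞ :=
  ⨅ (D : Set X) (_ : IsOpen D ∧ E ⊆ D), innerCap κ D

/-- `P` holds nearly everywhere (n.e.) on `A`: the exceptional subset of `A`
has inner capacity zero. -/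
def NearlyEverywhere (κ : X → X → ℝ≥0∞) (A : Set X) (P : X → Prop) : Prop :=
  innerCap κ {x ∈ A | ¬ P x} = 0

/-- The potential `U^μ(x) := ∫ κ(x,y) dμ(y)`. -/
def potential (κ : X → X → ℝ≥0∞) (μ : Measure X) (x : X) : ℝ≥0∞ :=
  ∫⁻ y, κ x y ∂μ

/-- An external field: `f = ψ + U^{ϑ⁺} − U^{ϑ⁻}` where `ψ` is lower semicontinuous,
`(−∞,∞]`-valued, positive if `X` is noncompact, and `ϑ⁺, ϑ⁻ ∈ E⁺`. -/
def IsExternalField (κ : X → X → ℝ≥0∞) (f : X → EReal) : Prop :=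
  ∃ (ψ : X → EReal) (ϑp ϑm : Measure X),
    LowerSemicontinuous ψ ∧ (∀ x, ψ x ≠ ⊥) ∧ (¬ CompactSpace X → ∀ x, 0 ≤ ψ x) ∧
    memEplus κ ϑp ∧ memEplus κ ϑm ∧
    ∀ x, f x = ψ x + (potential κ ϑp x : EReal) - (potential κ ϑm x : EReal)

/-- `f` is `μ`-integrable (as an extended-real-valued function). -/
def FieldIntegrable (f : X → EReal) (μ : Measure X) : Prop :=
  Integrable (fun x => (f x).toReal) μ ∧ (∀ᵐ x ∂μ, f x ≠ ⊤ ∧ f x ≠ ⊥)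

/-- `∫ f dμ` for an a.e.-finite integrable field. -/
def fieldIntegral (f : X → EReal) (μ : Measure X) : ℝ := ∫ x, (f x).toReal ∂μ

/-- The Gauss functional `I_f(μ) := I(μ) + 2 ∫ f dμ`. -/
def gaussI (κ : X → X → ℝ≥0∞) (f : X → EReal) (μ : Measure X) : ℝ :=
  (energy κ μ).toReal + 2 * fieldIntegral f μ

/-- Membership in `Ĕ⁺_f(A)`. -/
def Admissible (κ : X → X → ℝ≥0∞) (A : Set X) (f : X → EReal) (μ : Measure X) : Prop :=
  memBreve κ A μ ∧ FieldIntegrable f μ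

/-- `w_f(A) := inf { I_f(μ) : μ ∈ Ĕ⁺_f(A) }` (with `inf ∅ = ⊤`). -/
def wf (κ : X → X → ℝ≥0∞) (A : Set X) (f : X → EReal) : EReal :=
  ⨅ (μ : Measure X) (_ : Admissible κ A f μ), ((gaussI κ f μ : ℝ) : EReal)

/-- `l` is a solution of the inner Gauss variational problem for `(A,f)`. -/
def IsSolution (κ : X → X → ℝ≥0∞) (A : Set X) (f : X → EReal) (l : Measure X) : Prop :=
  Admissible κ A f l ∧ ((gaussI κ f l : ℝ) : EReal) = wf κ A f

/-- The `f`-weighted potential `U_f^μ := U^μ + f`. -/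
def wPotential (κ : X → X → ℝ≥0∞) (f : X → EReal) (μ : Measure X) (x : X) : EReal :=
  (potential κ μ x : EReal) + f x

/-- `∫ U_f^μ dμ`, the weighted equilibrium constant of a solution. -/
def wConst (κ : X → X → ℝ≥0∞) (f : X → EReal) (μ : Measure X) : ℝ :=
  ∫ x, (wPotential κ f μ x).toReal ∂μ

/-- The cone `E⁺(A)` is closed in the strong metric. -/
def StrongClosedEplusOn (κ : X → X → ℝ≥0∞) (A : Set X) : Prop :=
  ∀ (μ : ℕ → Measure X) (μ₀ : Measure X),
    (∀ n, memEplus κ (μ n) ∧ Concentrated (μ n) A) →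
    memEplus κ μ₀ → StrongTendstoSeq κ μ μ₀ → Concentrated μ₀ A

/-- Frostman's (first) maximum principle. -/
def FrostmanMax (κ : X → X → ℝ≥0∞) : Prop :=
  ∀ μ : Measure X, memEplus κ μ →
    (∀ x : X, (∀ U : Set X, IsOpen U → x ∈ U → 0 < μ U) → potential κ μ x ≤ 1) →
    ∀ x : X, potential κ μ x ≤ 1

/-- The domination (second maximum) principle. -/
def DominationPrinciple (κ : X → X → ℝ≥0∞) : Prop :=
  ∀ μ ν : Measure X, memEplus κ μ → memEplus κ ν →
    (∀ᵐ x ∂μ, potential κ μ x ≤ potential κ ν x) →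
    ∀ x : X, potential κ μ x ≤ potential κ ν x

/-- `β` is the inner balayage of `ζ` onto `A`: `β ∈ E⁺(A)` and `U^β = U^ζ` n.e. on `A`. -/
def IsInnerBalayage (κ : X → X → ℝ≥0∞) (A : Set X) (ζ β : Measure X) : Prop :=
  memEplus κ β ∧ Concentrated β A ∧
    NearlyEverywhere κ A (fun x => potential κ β x = potential κ ζ x)

/-- `γ` is the inner capacitary measure of `A`: `γ ∈ E⁺(A)` and `U^γ = 1` n.e. on `A`. -/
def IsCapacitaryMeasure (κ : X → X → ℝ≥0∞) (A : Set X) (γ : Measure X) : Prop :=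
  memEplus κ γ ∧ Concentrated γ A ∧
    NearlyEverywhere κ A (fun x => potential κ γ x = 1)

/-- `A` is quasiclosed: approximable in outer capacity by closed sets. -/
def Quasiclosed (κ : X → X → ℝ≥0∞) (A : Set X) : Prop :=
  ∀ ε : ℝ≥0∞, 0 < ε → ∃ F : Set X, IsClosed F ∧ outerCap κ (symmDiff A F) < ε

/-- `A` is quasicompact: approximable in outer capacity by compact sets. -/
def Quasicompact (κ : X → X → ℝ≥0∞) (A : Set X) : Prop :=
  ∀ ε : ℝ≥0∞, 0 < ε → ∃ K : Set X, IsCompact K ∧ outerCap κ (symmDiff A K) < ε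

set_option linter.unusedSectionVars false

section Topological

variable {X : Type*} [TopologicalSpace X] [MeasurableSpace X]

/-- Number of levels `δ, 2δ, …, Nδ` strictly below `a`, weighted by `δ`. -/
def levelSum (δ : ℝ≥0∞) (N : ℕ) (a : ℝ≥0∞) : ℝ≥0∞ :=
  ∑ k ∈ Finset.range N, if ((k : ℝ≥0∞) + 1) * δ < a then δ else 0

lemma levelSum_le (δ : ℝ≥0∞) (N : ℕ) (a : ℝ≥0∞) : levelSum δ N a ≤ min (N * δ) a := by
  induction N with
  | zero => simp [levelSum]
  | succ N ih =>
    rw [levelSum, Finset.sum_range_succ, ← levelSum]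
    split_ifs with h
    · have h1 : levelSum δ N a + δ ≤ ((N : ℝ≥0∞) + 1) * δ := by
        rw [add_mul, one_mul]
        gcongr
        exact ih.trans (min_le_left _ _)
      push_cast
      exact le_min h1 (h1.trans h.le)
    · rw [add_zero]
      refine ih.trans (min_le_min ?_ le_rfl)
      gcongr
      simp

lemma le_levelSum {δ : ℝ≥0∞} (hδ : δ ≠ ⊤) (N : ℕ) (a : ℝ≥0∞) :
    min (N * δ) (a - δ) ≤ levelSum δ N a := by
  induction N with
  | zero => simp
  | succ N ih =>
    rw [levelSum, Finset.sum_range_succ, ← levelSum]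
    split_ifs with h
    · have h1 : (N : ℝ≥0∞) * δ ≤ a - δ := by
        rw [add_mul, one_mul] at h
        exact ENNReal.le_sub_of_add_le_right hδ h.le
      rw [min_eq_left h1] at ih
      refine (min_le_left _ _).trans ?_
      push_cast
      rw [add_mul, one_mul]
      gcongr
    · rw [add_zero]
      refine le_trans ?_ ih
      have h1 : a - δ ≤ N * δ := by
        rw [tsub_le_iff_right]
        rw [not_lt, add_mul, one_mul] at h
        exact h
      exact le_min ((min_le_right _ _).trans h1) (min_le_right _ _)

lemma le_liminf_levelSum (a : ℝ≥0∞) :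
    a ≤ liminf (fun n : ℕ => levelSum ((n : ℝ≥0∞) + 1)⁻¹ ((n + 1) ^ 2) a) atTop := by
  have hlim : Tendsto (fun n : ℕ => min ((((n + 1) ^ 2 : ℕ) : ℝ≥0∞) * ((n : ℝ≥0∞) + 1)⁻¹)
      (a - ((n : ℝ≥0∞) + 1)⁻¹)) atTop (𝓝 a) := by
    have h0 : Tendsto (fun n : ℕ => (n : ℝ≥0∞) + 1) atTop (𝓝 ⊤) := by
      have := (tendsto_add_atTop_iff_nat (f := fun n : ℕ => (n : ℝ≥0∞)) 1).2
        ENNReal.tendsto_nat_nhds_top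
      simpa using this
    have h1 : Tendsto (fun n : ℕ => (((n + 1) ^ 2 : ℕ) : ℝ≥0∞) * ((n : ℝ≥0∞) + 1)⁻¹)
        atTop (𝓝 ⊤) := by
      refine h0.congr fun n => ?_
      push_cast
      rw [sq, mul_assoc, ENNReal.mul_inv_cancel (by simp) (by finiteness), mul_one]
    have h2 : Tendsto (fun n : ℕ => ((n : ℝ≥0∞) + 1)⁻¹) atTop (𝓝 0) := by
      simpa using h0.inv
    have h3 : Tendsto (fun n : ℕ => a - ((n : ℝ≥0∞) + 1)⁻¹) atTop (𝓝 (a - 0)) :=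
      ENNReal.Tendsto.sub tendsto_const_nhds h2 (Or.inr (by simp))
    simpa using h1.min h3
  refine hlim.liminf_eq.symm.le.trans ?_
  refine liminf_le_liminf (Eventually.of_forall fun n => le_levelSum ?_ _ _)
  simp

lemma lintegral_levelSum [OpensMeasurableSpace X] (μ : Measure X) (δ : ℝ≥0∞) (N : ℕ)
    {f : X → ℝ≥0∞} (hf : LowerSemicontinuous f) :
    ∫⁻ x, levelSum δ N (f x) ∂μ =
      ∑ k ∈ Finset.range N, δ * μ {x | ((k : ℝ≥0∞) + 1) * δ < f x} := by
  have hm : ∀ k : ℕ, MeasurableSet {x | ((k : ℝ≥0∞) + 1) * δ < f x} := fun k =>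
    (hf.isOpen_preimage _).measurableSet
  simp only [levelSum]
  rw [lintegral_finsetSum]
  · refine Finset.sum_congr rfl fun k _ => ?_
    rw [← lintegral_indicator_const (hm k)]
    exact lintegral_congr fun x => by simp [Set.indicator_apply]
  · intro k _
    exact Measurable.ite (hm k) measurable_const measurable_const

/-- A regular measure is continuous along directed families of open sets. -/
lemma measure_iUnion_of_directed_isOpen {ι : Type*} [Nonempty ι] (μ : Measure X) [μ.Regular]
    {U : ι → Set X} (hU : ∀ i, IsOpen (U i)) (hd : Directed (· ⊆ ·) U) :
    μ (⋃ i, U i) = ⨆ i, μ (U i) := by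
  refine le_antisymm ?_ (iSup_le fun i => measure_mono (subset_iUnion _ _))
  rw [(isOpen_iUnion hU).measure_eq_iSup_isCompact]
  refine iSup₂_le fun K hK => iSup_le fun hKc => ?_
  obtain ⟨i, hi⟩ := hKc.elim_directed_cover U hU hK hd
  exact (measure_mono hi).trans (le_iSup (fun i => μ (U i)) i)

/-- Monotone convergence for directed families of lower semicontinuous functions. -/
lemma lintegral_iSup_of_directed_lowerSemicontinuous [OpensMeasurableSpace X]
    {ι : Type*} [Nonempty ι] (μ : Measure X)
    [μ.Regular] {f : ι → X → ℝ≥0∞} (hf : ∀ i, LowerSemicontinuous (f i))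
    (hd : Directed (· ≤ ·) f) :
    ∫⁻ x, ⨆ i, f i x ∂μ = ⨆ i, ∫⁻ x, f i x ∂μ := by
  refine le_antisymm ?_ (iSup_le fun i => lintegral_mono fun x => le_iSup (fun i => f i x) i)
  have hs : LowerSemicontinuous fun x => ⨆ i, f i x := lowerSemicontinuous_iSup hf
  have hlevel : ∀ (δ : ℝ≥0∞) (N : ℕ), ∫⁻ x, levelSum δ N (⨆ i, f i x) ∂μ
      ≤ ⨆ i, ∫⁻ x, f i x ∂μ := by
    intro δ N
    have hunion : ∀ c : ℝ≥0∞, μ {x | c < ⨆ i, f i x} = ⨆ i, μ {x | c < f i x} := by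
      intro c
      have : {x | c < ⨆ i, f i x} = ⋃ i, {x | c < f i x} := by
        ext x; simp [lt_iSup_iff]
      rw [this]
      refine measure_iUnion_of_directed_isOpen μ (fun i => (hf i).isOpen_preimage c) ?_
      intro i j
      obtain ⟨k, hik, hjk⟩ := hd i j
      exact ⟨k, fun x hx => lt_of_lt_of_le hx (hik x), fun x hx => lt_of_lt_of_le hx (hjk x)⟩
    rw [lintegral_levelSum μ δ N hs]
    simp only [hunion, ENNReal.mul_iSup]
    rw [ENNReal.finsetSum_iSup]
    · refine iSup_mono fun i => ?_
      rw [← lintegral_levelSum μ δ N (hf i)]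
      exact lintegral_mono fun x => (levelSum_le δ N _).trans (min_le_right _ _)
    · intro i j
      obtain ⟨k, hik, hjk⟩ := hd i j
      refine ⟨k, fun a => ⟨?_, ?_⟩⟩
      · gcongr
        exact hik _
      · gcongr
        exact hjk _
  have hmeas : ∀ (δ : ℝ≥0∞) (N : ℕ), Measurable fun x => levelSum δ N (⨆ i, f i x) := by
    intro δ N
    refine Finset.measurable_fun_sum _ fun k _ => ?_
    exact Measurable.ite (hs.isOpen_preimage _).measurableSet measurable_const measurable_const
  calc ∫⁻ x, ⨆ i, f i x ∂μ
      ≤ ∫⁻ x, liminf (fun n : ℕ =>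
          levelSum ((n : ℝ≥0∞) + 1)⁻¹ ((n + 1) ^ 2) (⨆ i, f i x)) atTop ∂μ :=
        lintegral_mono fun x => le_liminf_levelSum _
    _ ≤ liminf (fun n : ℕ => ∫⁻ x,
          levelSum ((n : ℝ≥0∞) + 1)⁻¹ ((n + 1) ^ 2) (⨆ i, f i x) ∂μ) atTop :=
        lintegral_liminf_le fun n => hmeas _ _
    _ ≤ liminf (fun _ : ℕ => ⨆ i, ∫⁻ x, f i x ∂μ) atTop :=
        liminf_le_liminf (Eventually.of_forall fun n => hlevel _ _)
    _ = ⨆ i, ∫⁻ x, f i x ∂μ := liminf_const _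

end Topological

section Kernel

variable {X : Type*} [TopologicalSpace X] [MeasurableSpace X]

/-- Constant minorants of a kernel on open rectangles. -/
def Minorant (κ : X → X → ℝ≥0∞) : Type _ :=
  {b : ℝ≥0∞ × Set X × Set X //
    IsOpen b.2.1 ∧ IsOpen b.2.2 ∧ ∀ x ∈ b.2.1, ∀ y ∈ b.2.2, b.1 ≤ κ x y}

/-- The step function that is the supremum of finitely many rectangular minorants. -/
def minorantSup {κ : X → X → ℝ≥0∞} (s : Finset (Minorant κ)) (x y : X) : ℝ≥0∞ :=
  ⨆ b ∈ s, (b.1.2.1 ×ˢ b.1.2.2).indicator (fun _ => b.1.1) (x, y)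

lemma minorantSup_mono {κ : X → X → ℝ≥0∞} (x y : X) :
    Monotone fun s : Finset (Minorant κ) => minorantSup s x y :=
  fun _ _ hst => biSup_mono fun _ hb => hst hb

lemma minorantSup_le {κ : X → X → ℝ≥0∞} (s : Finset (Minorant κ)) (x y : X) :
    minorantSup s x y ≤ κ x y := by
  refine iSup₂_le fun b _ => ?_
  by_cases h : (x, y) ∈ b.1.2.1 ×ˢ b.1.2.2
  · rw [indicator_of_mem h]
    exact b.2.2.2 x h.1 y h.2
  · rw [indicator_of_notMem h]
    exact zero_le

lemma iSup_minorantSup {κ : X → X → ℝ≥0∞} (hκ : IsKernel κ) (x y : X) :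
    ⨆ s : Finset (Minorant κ), minorantSup s x y = κ x y := by
  refine le_antisymm (iSup_le fun s => minorantSup_le s x y) (le_of_forall_lt fun c hc => ?_)
  obtain ⟨c', hcc', hc'⟩ := exists_between hc
  obtain ⟨U, V, hU, hV, hx, hy, hUV⟩ :=
    isOpen_prod_iff.1 (hκ.2.isOpen_preimage c') x y hc'
  let b : Minorant κ := ⟨(c', U, V), hU, hV, fun x hx y hy =>
    (show c' < κ x y from hUV (mk_mem_prod hx hy)).le⟩
  refine hcc'.trans_le (le_trans ?_ (le_iSup _ {b}))
  have : (x, y) ∈ U ×ˢ V := ⟨hx, hy⟩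
  exact (indicator_of_mem this (fun _ => c')).symm.le.trans
    (le_iSup₂ (f := fun (d : Minorant κ) (_ : d ∈ ({b} : Finset (Minorant κ))) =>
      (d.1.2.1 ×ˢ d.1.2.2).indicator (fun _ => d.1.1) (x, y)) b (Finset.mem_singleton_self b))

lemma directed_minorantSup {κ : X → X → ℝ≥0∞} (x : X) :
    Directed (· ≤ ·) fun s : Finset (Minorant κ) => minorantSup s x := by
  classical
  exact Monotone.directed_le fun _ _ hst y => minorantSup_mono x y hst

lemma lowerSemicontinuous_indicator_prod {U V : Set X} (hU : IsOpen U) (hV : IsOpen V)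
    (c : ℝ≥0∞) : LowerSemicontinuous ((U ×ˢ V).indicator fun _ => c) :=
  (hU.prod hV).lowerSemicontinuous_indicator zero_le

lemma lowerSemicontinuous_minorantSup {κ : X → X → ℝ≥0∞} (s : Finset (Minorant κ)) (x : X) :
    LowerSemicontinuous (minorantSup s x) := by
  refine lowerSemicontinuous_biSup fun b _ => ?_
  exact (lowerSemicontinuous_indicator_prod b.2.1 b.2.2.1 _).comp (by fun_prop)

lemma measurable_minorantSup [OpensMeasurableSpace X] {κ : X → X → ℝ≥0∞}
    (s : Finset (Minorant κ)) : Measurable fun p : X × X => minorantSup s p.1 p.2 := by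
  refine Measurable.biSup _ s.countable_toSet fun b _ => ?_
  exact measurable_const.indicator (b.2.1.measurableSet.prod b.2.2.1.measurableSet)

lemma IsKernel.lowerSemicontinuous_right {κ : X → X → ℝ≥0∞} (hκ : IsKernel κ) (x : X) :
    LowerSemicontinuous (κ x) :=
  hκ.2.comp (g := fun y => (x, y)) (by fun_prop)

lemma potential_eq_iSup [OpensMeasurableSpace X] {κ : X → X → ℝ≥0∞} (hκ : IsKernel κ)
    (μ : Measure X) [μ.Regular] (x : X) :
    potential κ μ x = ⨆ s : Finset (Minorant κ), ∫⁻ y, minorantSup s x y ∂μ := by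
  rw [← lintegral_iSup_of_directed_lowerSemicontinuous μ
    (fun s => lowerSemicontinuous_minorantSup s x) (directed_minorantSup x)]
  simp only [iSup_minorantSup hκ, potential]

lemma lowerSemicontinuous_lintegral_minorantSup {κ : X → X → ℝ≥0∞} (s : Finset (Minorant κ))
    (μ : Measure X) : LowerSemicontinuous fun x => ∫⁻ y, minorantSup s x y ∂μ := by
  intro x₀ a ha
  have hev : ∀ᶠ x in 𝓝 x₀, ∀ b ∈ s, x₀ ∈ b.1.2.1 → x ∈ b.1.2.1 := by
    rw [Filter.eventually_all_finset]
    intro b _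
    by_cases h : x₀ ∈ b.1.2.1
    · filter_upwards [b.2.1.mem_nhds h] with x hx _ using hx
    · exact Eventually.of_forall fun x hx => absurd hx h
  filter_upwards [hev] with x hx
  refine lt_of_lt_of_le ha (lintegral_mono fun y => iSup₂_mono fun b hb => ?_)
  by_cases h : (x₀, y) ∈ b.1.2.1 ×ˢ b.1.2.2
  · rw [indicator_of_mem h, indicator_of_mem (show (x, y) ∈ b.1.2.1 ×ˢ b.1.2.2 from
      ⟨hx b hb h.1, h.2⟩)]
  · rw [indicator_of_notMem h]
    exact zero_le

lemma lowerSemicontinuous_potential [OpensMeasurableSpace X] {κ : X → X → ℝ≥0∞} (hκ : IsKernel κ)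
    (μ : Measure X) [μ.Regular] : LowerSemicontinuous (potential κ μ) := by
  rw [show potential κ μ = fun x => ⨆ s : Finset (Minorant κ), ∫⁻ y, minorantSup s x y ∂μ from
    funext (potential_eq_iSup hκ μ)]
  exact lowerSemicontinuous_iSup fun s => lowerSemicontinuous_lintegral_minorantSup s μ

lemma measurable_potential [BorelSpace X] {κ : X → X → ℝ≥0∞} (hκ : IsKernel κ)
    (μ : Measure X) [μ.Regular] : Measurable (potential κ μ) :=
  (lowerSemicontinuous_potential hκ μ).measurable

lemma mutualEnergy_le_lintegral_potential (κ : X → X → ℝ≥0∞) (μ ν : Measure X) :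
    mutualEnergy κ μ ν ≤ ∫⁻ x, potential κ ν x ∂μ := by
  rw [mutualEnergy, Measure.prod]
  refine (Measure.lintegral_bind_le _ _ _).trans (lintegral_mono fun x => ?_)
  exact lintegral_map_le _ _

lemma lintegral_potential_le_mutualEnergy [OpensMeasurableSpace X] {κ : X → X → ℝ≥0∞}
    (hκ : IsKernel κ) (μ ν : Measure X) [μ.Regular] [ν.Regular]
    (h : AEMeasurable (fun x => Measure.map (Prod.mk x) ν) μ) :
    ∫⁻ x, potential κ ν x ∂μ ≤ mutualEnergy κ μ ν := by
  simp only [potential_eq_iSup hκ]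
  rw [lintegral_iSup_of_directed_lowerSemicontinuous μ
    (fun s => lowerSemicontinuous_lintegral_minorantSup s ν)]
  · refine iSup_le fun s => ?_
    have hm := measurable_minorantSup s
    calc ∫⁻ x, ∫⁻ y, minorantSup s x y ∂ν ∂μ
        = ∫⁻ x, ∫⁻ p, minorantSup s p.1 p.2 ∂(Measure.map (Prod.mk x) ν) ∂μ := by
          refine lintegral_congr fun x => ?_
          rw [lintegral_map hm measurable_prodMk_left]
      _ = ∫⁻ p, minorantSup s p.1 p.2 ∂(μ.prod ν) := by
          rw [Measure.prod, Measure.lintegral_bind h hm.aemeasurable]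
      _ ≤ mutualEnergy κ μ ν := lintegral_mono fun p => minorantSup_le s _ _
  · classical
    exact Monotone.directed_le fun _ _ hst x =>
      lintegral_mono fun y => minorantSup_mono x y hst

lemma mutualEnergy_eq_lintegral [OpensMeasurableSpace X] {κ : X → X → ℝ≥0∞}
    (hκ : IsKernel κ) (μ ν : Measure X) [μ.Regular] [ν.Regular] [SFinite ν] :
    mutualEnergy κ μ ν = ∫⁻ x, potential κ ν x ∂μ :=
  le_antisymm
    (mutualEnergy_le_lintegral_potential κ μ ν)
    (lintegral_potential_le_mutualEnergy hκ μ ν Measurable.map_prodMk_left.aemeasurable)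

lemma mutualEnergy_comm {κ : X → X → ℝ≥0∞} (hκ : IsKernel κ) (μ ν : Measure X)
    [SFinite μ] [SFinite ν] : mutualEnergy κ μ ν = mutualEnergy κ ν μ := by
  rw [mutualEnergy, mutualEnergy, ← Measure.prod_swap,
    show (Prod.swap : X × X → X × X) = MeasurableEquiv.prodComm from rfl, lintegral_map_equiv]
  exact lintegral_congr fun p => hκ.1 _ _

end Kernel

section Radon

variable {X : Type*} [TopologicalSpace X] [MeasurableSpace X]

lemma regular_add (μ ν : Measure X) [μ.Regular] [ν.Regular] : (μ + ν).Regular where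
  lt_top_of_isCompact K hK := by
    simpa using ⟨hK.measure_lt_top (μ := μ), hK.measure_lt_top (μ := ν)⟩
  outerRegular := by
    intro A _ r hr
    obtain ⟨ε, hε, hεr⟩ := ENNReal.lt_iff_exists_add_pos_lt.1 hr
    have hfin : μ A + ν A ≠ ⊤ := hr.ne_top
    have hε2 : (ε : ℝ≥0∞) / 2 ≠ 0 := by simpa using hε.ne'
    obtain ⟨U, hAU, hU, hμU⟩ := A.exists_isOpen_lt_add (μ := μ)
      (fun h => hfin (by simp [h])) hε2
    obtain ⟨V, hAV, hV, hνV⟩ := A.exists_isOpen_lt_add (μ := ν)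
      (fun h => hfin (by simp [h])) hε2
    refine ⟨U ∩ V, subset_inter hAU hAV, hU.inter hV, lt_of_le_of_lt ?_ hεr⟩
    calc (μ + ν) (U ∩ V) = μ (U ∩ V) + ν (U ∩ V) := rfl
      _ ≤ μ U + ν V := add_le_add (measure_mono inter_subset_left) (measure_mono inter_subset_right)
      _ ≤ (μ A + ε / 2) + (ν A + ε / 2) := add_le_add hμU.le hνV.le
      _ = μ A + ν A + (ε / 2 + ε / 2) := by ring
      _ = (μ + ν) A + ε := by rw [ENNReal.add_halves]; rfl
  innerRegular := by
    intro U hU r hr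
    simp only [Measure.coe_add, Pi.add_apply] at hr
    rcases eq_or_ne (μ U) 0 with h | h
    · rw [h, zero_add] at hr
      obtain ⟨K, hKU, hK, hrK⟩ := hU.exists_lt_isCompact hr
      exact ⟨K, hKU, hK, hrK.trans_le (by simp)⟩
    rcases eq_or_ne (ν U) 0 with h' | h'
    · rw [h', add_zero] at hr
      obtain ⟨K, hKU, hK, hrK⟩ := hU.exists_lt_isCompact hr
      exact ⟨K, hKU, hK, hrK.trans_le (by simp)⟩
    obtain ⟨u, hu, v, hv, huv⟩ := ENNReal.exists_lt_add_of_lt_add hr h h'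
    obtain ⟨K, hKU, hK, hrK⟩ := hU.exists_lt_isCompact hu
    obtain ⟨L, hLU, hL, hrL⟩ := hU.exists_lt_isCompact hv
    refine ⟨K ∪ L, union_subset hKU hLU, hK.union hL, huv.trans_le ?_⟩
    exact (add_le_add hrK.le hrL.le).trans
      (add_le_add (measure_mono subset_union_left) (measure_mono subset_union_right))

lemma regular_dirac [T1Space X] [OpensMeasurableSpace X] (x : X) :
    (Measure.dirac x).Regular where
  lt_top_of_isCompact K _ := measure_lt_top _ K
  outerRegular := by
    intro A hA r hr
    by_cases hx : x ∈ A
    · exact ⟨univ, subset_univ _, isOpen_univ, by simpa [hA, hx] using hr⟩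
    · refine ⟨{x}ᶜ, fun y hy => ?_, isOpen_compl_singleton, ?_⟩
      · rintro rfl
        exact hx hy
      · simpa [hA, hx] using hr
  innerRegular := by
    intro U hU r hr
    by_cases hx : x ∈ U
    · exact ⟨{x}, by simpa using hx, isCompact_singleton, by simpa [hU.measurableSet, hx] using hr⟩
    · simp [hU.measurableSet, hx] at hr

/-- For a `σ`-finite Radon measure, a locally negligible complement is negligible. -/
lemma Concentrated.ae_mem [T2Space X] [BorelSpace X] {μ : Measure X} [μ.Regular]
    [SigmaFinite μ] {A : Set X} (h : Concentrated μ A) : ∀ᵐ x ∂μ, x ∈ A := by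
  have hn : ∀ n, μ (Aᶜ ∩ spanningSets μ n) = 0 := by
    intro n
    refine nonpos_iff_eq_zero.1 (_root_.le_of_forall_pos_le_add fun ε hε => ?_)
    obtain ⟨K, hK, hKc, hKε⟩ := (measurableSet_spanningSets μ n).exists_isCompact_sdiff_lt
      (measure_spanningSets_lt_top μ n).ne hε.ne'
    calc μ (Aᶜ ∩ spanningSets μ n) ≤ μ ((Aᶜ ∩ K) ∪ (spanningSets μ n \ K)) := by
          refine measure_mono fun x hx => ?_
          by_cases hxK : x ∈ K
          · exact Or.inl ⟨hx.1, hxK⟩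
          · exact Or.inr ⟨hx.2, hxK⟩
      _ ≤ μ (Aᶜ ∩ K) + μ (spanningSets μ n \ K) := measure_union_le _ _
      _ ≤ 0 + ε := by rw [h K hKc]; gcongr
  change μ Aᶜ = 0
  rw [← inter_univ Aᶜ, ← iUnion_spanningSets μ, inter_iUnion]
  exact measure_iUnion_null hn

lemma concentrated_of_ae {μ : Measure X} {A : Set X} (h : ∀ᵐ x ∂μ, x ∈ A) : Concentrated μ A :=
  fun _ _ => measure_mono_null inter_subset_left h

end Radon

section Energy

variable {X : Type*} [TopologicalSpace X] [MeasurableSpace X]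
  {κ : X → X → ℝ≥0∞} {μ ν ρ : Measure X}

lemma EnergyPrinciple.diag_ne_zero [T2Space X] [BorelSpace X] (hE : EnergyPrinciple κ)
    (hκ : IsKernel κ) (x : X) : κ x x ≠ 0 := by
  intro h0
  have hreg := regular_dirac x
  have hen : energy κ (Measure.dirac x) = 0 := by
    rw [energy, mutualEnergy_eq_lintegral hκ, lintegral_dirac' _ (measurable_potential hκ _),
      potential, lintegral_dirac' _ (hκ.lowerSemicontinuous_right x).measurable, h0]
  have hz : energy κ (0 : Measure X) = 0 := by simp [energy, mutualEnergy]
  have hm : mutualEnergy κ (Measure.dirac x) 0 = 0 := by simp [mutualEnergy]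
  have h := (hE (Measure.dirac x) 0 ⟨hreg, by simp [hen]⟩
    ⟨inferInstanceAs (Measure.Regular 0), by simp [hz]⟩).2 (by simp [hen, hz, hm])
  exact (Measure.dirac_ne_zero) h

lemma potential_pos_of_mem_support [OpensMeasurableSpace X] (hκ : IsKernel κ)
    {x : X} (hx : x ∈ μ.support) (h0 : κ x x ≠ 0) : potential κ μ x ≠ 0 := by
  obtain ⟨c, hc0, hc⟩ := exists_between (pos_iff_ne_zero.2 h0)
  have hV : IsOpen {y | c < κ x y} := (hκ.lowerSemicontinuous_right x).isOpen_preimage c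
  have hpos : 0 < μ {y | c < κ x y} :=
    (Measure.mem_support_iff_forall x).1 hx _ (hV.mem_nhds hc)
  have hle : c * μ {y | c < κ x y} ≤ potential κ μ x := by
    rw [← lintegral_indicator_const hV.measurableSet]
    refine lintegral_mono fun y => ?_
    by_cases hy : c < κ x y
    · rw [indicator_of_mem (show y ∈ {y | c < κ x y} from hy)]
      exact hy.le
    · rw [indicator_of_notMem (show y ∉ {y | c < κ x y} from hy)]
      exact zero_le
  exact ((ENNReal.mul_pos hc0.ne' hpos.ne').trans_le hle).ne'

/-- Under the energy principle, measures of finite energy are `σ`-finite. -/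
lemma memEplus.sigmaFinite [T2Space X] [BorelSpace X] (hE : EnergyPrinciple κ)
    (hκ : IsKernel κ) (hμ : memEplus κ μ) : SigmaFinite μ := by
  have hreg : μ.Regular := hμ.1
  by_cases h : AEMeasurable (fun x => Measure.map (Prod.mk x) μ) μ
  · have hfin : ∫⁻ x, potential κ μ x ∂μ < ⊤ :=
      (lintegral_potential_le_mutualEnergy hκ μ μ h).trans_lt hμ.2
    have hm := measurable_potential hκ μ
    refine Measure.sigmaFinite_of_countable
      (S := insert {x | potential κ μ x = 0}
        (range fun n : ℕ => {x | ((n : ℝ≥0∞) + 1)⁻¹ ≤ potential κ μ x}))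
      ((countable_range _).insert _) ?_ ?_
    · rintro s (rfl | ⟨n, rfl⟩)
      · have : μ {x | potential κ μ x = 0} = 0 := by
          refine measure_mono_null (t := μ.supportᶜ) (fun x hx hxs => ?_) (Measure.measure_compl_support_of_regular)
          exact potential_pos_of_mem_support hκ hxs (hE.diag_ne_zero hκ x) hx
        simp [this]
      · refine (meas_ge_le_lintegral_div hm.aemeasurable (by simp) (by simp)).trans_lt ?_
        exact ENNReal.div_lt_top hfin.ne (by simp)
    · refine eq_univ_of_forall fun x => ?_
      by_cases hx : potential κ μ x = 0
      · exact ⟨_, mem_insert _ _, hx⟩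
      · obtain ⟨n, hn⟩ := ENNReal.exists_inv_nat_lt hx
        refine ⟨_, mem_insert_of_mem _ ⟨n, rfl⟩, le_trans ?_ hn.le⟩
        exact ENNReal.inv_le_inv.2 le_self_add
  · have hprod : μ.prod μ = 0 := by
      rw [Measure.prod, Measure.bind, Measure.map_of_not_aemeasurable h, Measure.join_zero]
    have hen : energy κ μ = 0 := by simp [energy, mutualEnergy, hprod]
    have hz : energy κ (0 : Measure X) = 0 := by simp [energy, mutualEnergy]
    have hm : mutualEnergy κ μ 0 = 0 := by simp [mutualEnergy]
    have h0 := (hE μ 0 hμ ⟨inferInstanceAs (Measure.Regular 0), by simp [hz]⟩).2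
      (by simp [hen, hz, hm])
    rw [h0]
    infer_instance

variable [T2Space X] [BorelSpace X]

lemma memEplus.mutualEnergy_eq (hE : EnergyPrinciple κ) (hκ : IsKernel κ)
    (hμ : memEplus κ μ) (hν : memEplus κ ν) :
    mutualEnergy κ μ ν = ∫⁻ x, potential κ ν x ∂μ := by
  have := hμ.sigmaFinite hE hκ
  have := hν.sigmaFinite hE hκ
  have : μ.Regular := hμ.1
  have : ν.Regular := hν.1
  exact mutualEnergy_eq_lintegral hκ μ ν

lemma memEplus.mutualEnergy_comm (hE : EnergyPrinciple κ) (hκ : IsKernel κ)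
    (hμ : memEplus κ μ) (hν : memEplus κ ν) : mutualEnergy κ μ ν = mutualEnergy κ ν μ := by
  have := hμ.sigmaFinite hE hκ
  have := hν.sigmaFinite hE hκ
  exact GaussVar.mutualEnergy_comm hκ μ ν

lemma EnergyPrinciple.mutualEnergy_ne_top (hE : EnergyPrinciple κ)
    (hμ : memEplus κ μ) (hν : memEplus κ ν) : mutualEnergy κ μ ν ≠ ⊤ := by
  intro h
  have := (hE μ ν hμ hν).1.trans_lt (ENNReal.add_lt_top.2 ⟨hμ.2, hν.2⟩)
  simp [h] at this

lemma memEplus.measurable_potential (hκ : IsKernel κ) (hμ : memEplus κ μ) :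
    Measurable (potential κ μ) := by
  have : μ.Regular := hμ.1
  exact GaussVar.measurable_potential hκ μ

lemma potential_add (κ : X → X → ℝ≥0∞) (μ ν : Measure X) (x : X) :
    potential κ (μ + ν) x = potential κ μ x + potential κ ν x :=
  lintegral_add_measure _ _ _

lemma potential_smul (κ : X → X → ℝ≥0∞) (c : ℝ≥0∞) (μ : Measure X) (x : X) :
    potential κ (c • μ) x = c * potential κ μ x :=
  lintegral_smul_measure _ _

lemma memEplus.add (hE : EnergyPrinciple κ) (hκ : IsKernel κ)
    (hμ : memEplus κ μ) (hν : memEplus κ ν) : memEplus κ (μ + ν) := by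
  have := hμ.sigmaFinite hE hκ
  have := hν.sigmaFinite hE hκ
  have : μ.Regular := hμ.1
  have : ν.Regular := hν.1
  have hreg := regular_add μ ν
  refine ⟨hreg, ?_⟩
  rw [energy, mutualEnergy_eq_lintegral hκ]
  simp only [potential_add]
  rw [lintegral_add_measure, lintegral_add_left (hμ.measurable_potential hκ),
    lintegral_add_left (hμ.measurable_potential hκ), ← hμ.mutualEnergy_eq hE hκ hμ,
    ← hμ.mutualEnergy_eq hE hκ hν, ← hν.mutualEnergy_eq hE hκ hμ, ← hν.mutualEnergy_eq hE hκ hν]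
  exact ENNReal.add_lt_top.2
    ⟨ENNReal.add_lt_top.2 ⟨hμ.2, (hE.mutualEnergy_ne_top hμ hν).lt_top⟩,
      ENNReal.add_lt_top.2 ⟨(hE.mutualEnergy_ne_top hν hμ).lt_top, hν.2⟩⟩

lemma memEplus.smul (hE : EnergyPrinciple κ) (hκ : IsKernel κ) {c : ℝ≥0∞} (hc : c ≠ ⊤)
    (hμ : memEplus κ μ) : memEplus κ (c • μ) := by
  have := hμ.sigmaFinite hE hκ
  have : μ.Regular := hμ.1
  have hreg := Measure.Regular.smul (μ := μ) hc
  lift c to NNReal using hc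
  have : SFinite ((c : ℝ≥0∞) • μ) := inferInstance
  refine ⟨hreg, ?_⟩
  rw [energy, mutualEnergy_eq_lintegral hκ]
  simp only [potential_smul]
  rw [lintegral_smul_measure, lintegral_const_mul _ (hμ.measurable_potential hκ),
    ← hμ.mutualEnergy_eq hE hκ hμ]
  exact ENNReal.mul_lt_top coe_lt_top (ENNReal.mul_lt_top coe_lt_top hμ.2)

lemma memEplus.restrict (hE : EnergyPrinciple κ) (hκ : IsKernel κ) {C : Set X}
    (hC : μ C ≠ ⊤) (hμ : memEplus κ μ) : memEplus κ (μ.restrict C) := by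
  have := hμ.sigmaFinite hE hκ
  have : μ.Regular := hμ.1
  have hreg := Measure.Regular.restrict_of_measure_ne_top (μ := μ) hC
  refine ⟨hreg, ?_⟩
  have hle : ∫⁻ x, potential κ (μ.restrict C) x ∂(μ.restrict C) ≤ ∫⁻ x, potential κ μ x ∂μ :=
    lintegral_mono' Measure.restrict_le_self
      fun x => lintegral_mono' Measure.restrict_le_self le_rfl
  rw [energy, mutualEnergy_eq_lintegral hκ]
  rw [← hμ.mutualEnergy_eq hE hκ hμ] at hle
  exact hle.trans_lt hμ.2

/-- A measure of finite energy charging a measurable set can be localised to that set and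
normalised. -/
lemma memEplus.exists_normalized_restrict (hE : EnergyPrinciple κ) (hκ : IsKernel κ)
    (hμ : memEplus κ μ) {B : Set X} (hB : MeasurableSet B) (h0 : μ B ≠ 0) :
    ∃ ρ : Measure X, memEplus κ ρ ∧ ρ univ = 1 ∧ ρ ≪ μ ∧ ∀ᵐ x ∂ρ, x ∈ B := by
  have := hμ.sigmaFinite hE hκ
  obtain ⟨C, hC, hCm, hCB, hCtop⟩ : ∃ C, μ C ≠ 0 ∧ MeasurableSet C ∧ C ⊆ B ∧ μ C ≠ ⊤ := by
    obtain ⟨n, hn⟩ : ∃ n, μ (B ∩ spanningSets μ n) ≠ 0 := by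
      by_contra! hcon
      apply h0
      rw [← inter_univ B, ← iUnion_spanningSets μ, inter_iUnion]
      exact measure_iUnion_null hcon
    exact ⟨_, hn, hB.inter (measurableSet_spanningSets μ n), inter_subset_left,
      ((measure_mono inter_subset_right).trans_lt (measure_spanningSets_lt_top μ n)).ne⟩
  have hac : (μ C)⁻¹ • μ.restrict C ≪ μ.restrict C := Measure.smul_absolutelyContinuous
  refine ⟨(μ C)⁻¹ • μ.restrict C, (hμ.restrict hE hκ hCtop).smul hE hκ (by simpa using hC), ?_,
    hac.trans Measure.restrict_le_self.absolutelyContinuous, hac ?_⟩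
  · simp [ENNReal.inv_mul_cancel hC hCtop]
  · filter_upwards [ae_restrict_mem hCm] with x hx using hCB hx

lemma wcap_lt_top_iff {A : Set X} : wcap κ A < ⊤ ↔ ∃ μ, memBreve κ A μ := by
  simp only [wcap, iInf_lt_iff]
  exact ⟨fun ⟨μ, hμ, _⟩ => ⟨μ, hμ⟩, fun ⟨μ, hμ⟩ => ⟨μ, hμ, hμ.1.2⟩⟩

lemma nearlyEverywhere_of_ae (hE : EnergyPrinciple κ) (hκ : IsKernel κ) {A : Set X}
    {P : X → Prop} (h : ∀ ν, memEplus κ ν → Concentrated ν A → ∀ᵐ x ∂ν, P x) :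
    NearlyEverywhere κ A P := by
  rw [NearlyEverywhere, innerCap, ENNReal.inv_eq_zero]
  by_contra hne
  obtain ⟨ρ, hρ, hρA, hρ1⟩ := wcap_lt_top_iff.1 (lt_top_iff_ne_top.2 hne)
  have := hρ.sigmaFinite hE hκ
  have : ρ.Regular := hρ.1
  have hae := hρA.ae_mem
  have hP := h ρ hρ (concentrated_of_ae (hae.mono fun x hx => hx.1))
  have hfalse : ∀ᵐ _ ∂ρ, False := by
    filter_upwards [hae, hP] with x hx hx' using hx.2 hx'
  rw [eventually_false_iff_eq_bot, ae_eq_bot] at hfalse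
  simp [hfalse] at hρ1

lemma NearlyEverywhere.ae (hE : EnergyPrinciple κ) (hκ : IsKernel κ) {A : Set X}
    {P : X → Prop} (h : NearlyEverywhere κ A P) (hP : MeasurableSet {x | P x})
    (hν : memEplus κ ν) (hνA : Concentrated ν A) : ∀ᵐ x ∂ν, P x := by
  by_contra hne
  obtain ⟨ρ, hρ, hρ1, hρν, hρB⟩ := hν.exists_normalized_restrict hE hκ hP.compl hne
  have := hν.sigmaFinite hE hκ
  have : ν.Regular := hν.1
  have hmem : memBreve κ {x ∈ A | ¬ P x} ρ :=
    ⟨hρ, concentrated_of_ae (by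
      filter_upwards [hρB, hρν hνA.ae_mem] with x hx hxA using ⟨hxA, hx⟩), hρ1⟩
  rw [NearlyEverywhere, innerCap, ENNReal.inv_eq_zero] at h
  exact (wcap_lt_top_iff.2 ⟨ρ, hmem⟩).ne h

/-- The mutual energy as a real number. -/
def pairing (κ : X → X → ℝ≥0∞) (μ ν : Measure X) : ℝ := (mutualEnergy κ μ ν).toReal

lemma pairing_comm (hE : EnergyPrinciple κ) (hκ : IsKernel κ)
    (hμ : memEplus κ μ) (hν : memEplus κ ν) : pairing κ μ ν = pairing κ ν μ := by
  rw [pairing, pairing, hμ.mutualEnergy_comm hE hκ hν]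

lemma pairing_add_left (hE : EnergyPrinciple κ) (hκ : IsKernel κ)
    (hμ : memEplus κ μ) (hν : memEplus κ ν) (hρ : memEplus κ ρ) :
    pairing κ (μ + ν) ρ = pairing κ μ ρ + pairing κ ν ρ := by
  rw [pairing, (hμ.add hE hκ hν).mutualEnergy_eq hE hκ hρ, lintegral_add_measure,
    ← hμ.mutualEnergy_eq hE hκ hρ, ← hν.mutualEnergy_eq hE hκ hρ,
    ENNReal.toReal_add (hE.mutualEnergy_ne_top hμ hρ) (hE.mutualEnergy_ne_top hν hρ)]
  rfl

lemma pairing_smul_left (hE : EnergyPrinciple κ) (hκ : IsKernel κ) {c : ℝ≥0∞} (hc : c ≠ ⊤)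
    (hμ : memEplus κ μ) (hρ : memEplus κ ρ) :
    pairing κ (c • μ) ρ = c.toReal * pairing κ μ ρ := by
  rw [pairing, (hμ.smul hE hκ hc).mutualEnergy_eq hE hκ hρ, lintegral_smul_measure,
    ← hμ.mutualEnergy_eq hE hκ hρ, smul_eq_mul, ENNReal.toReal_mul]
  rfl

/-- Expansion of the energy of a combination with nonnegative coefficients. -/
lemma pairing_combination (hE : EnergyPrinciple κ) (hκ : IsKernel κ) {a b : ℝ≥0∞} (ha : a ≠ ⊤)
    (hb : b ≠ ⊤) (hμ : memEplus κ μ) (hν : memEplus κ ν) :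
    pairing κ (a • μ + b • ν) (a • μ + b • ν) = a.toReal ^ 2 * pairing κ μ μ
      + 2 * a.toReal * b.toReal * pairing κ μ ν + b.toReal ^ 2 * pairing κ ν ν := by
  have haμ := hμ.smul hE hκ ha
  have hbν := hν.smul hE hκ hb
  have hs := haμ.add hE hκ hbν
  rw [pairing_add_left hE hκ haμ hbν hs, pairing_smul_left hE hκ ha hμ hs,
    pairing_smul_left hE hκ hb hν hs, pairing_comm hE hκ hμ hs, pairing_comm hE hκ hν hs,
    pairing_add_left hE hκ haμ hbν hμ, pairing_add_left hE hκ haμ hbν hν,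
    pairing_smul_left hE hκ ha hμ hμ, pairing_smul_left hE hκ hb hν hμ,
    pairing_smul_left hE hκ ha hμ hν, pairing_smul_left hE hκ hb hν hν, pairing_comm hE hκ hν hμ]
  ring

lemma EnergyPrinciple.two_mul_pairing_le (hE : EnergyPrinciple κ)
    (hμ : memEplus κ μ) (hν : memEplus κ ν) :
    2 * pairing κ μ ν ≤ pairing κ μ μ + pairing κ ν ν := by
  have h := ENNReal.toReal_mono (ENNReal.add_ne_top.2 ⟨hμ.2.ne, hν.2.ne⟩) (hE μ ν hμ hν).1
  rwa [ENNReal.toReal_mul, ENNReal.toReal_add hμ.2.ne hν.2.ne] at h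

lemma EnergyPrinciple.eq_of_le_two_mul_pairing (hE : EnergyPrinciple κ)
    (hμ : memEplus κ μ) (hν : memEplus κ ν)
    (h : pairing κ μ μ + pairing κ ν ν ≤ 2 * pairing κ μ ν) : μ = ν := by
  refine (hE μ ν hμ hν).2 ?_
  have hfin := hE.mutualEnergy_ne_top hμ hν
  rw [← ENNReal.toReal_eq_toReal_iff' (by finiteness)
    (ENNReal.add_ne_top.2 ⟨hμ.2.ne, hν.2.ne⟩), ENNReal.toReal_mul,
    ENNReal.toReal_add hμ.2.ne hν.2.ne]
  exact le_antisymm (hE.two_mul_pairing_le hμ hν) h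

lemma EnergyPrinciple.strongDist_sq (hE : EnergyPrinciple κ)
    (hμ : memEplus κ μ) (hν : memEplus κ ν) :
    strongDist κ μ ν ^ 2 = pairing κ μ μ + pairing κ ν ν - 2 * pairing κ μ ν :=
  Real.sq_sqrt (sub_nonneg.2 (hE.two_mul_pairing_le hμ hν))

/-- The Cauchy–Schwarz inequality for a difference of measures of finite energy. -/
lemma EnergyPrinciple.sq_pairing_sub_le (hE : EnergyPrinciple κ) (hκ : IsKernel κ)
    (hμ : memEplus κ μ) (hν : memEplus κ ν) (hρ : memEplus κ ρ) :
    (pairing κ μ ρ - pairing κ ν ρ) ^ 2 ≤ strongDist κ μ ν ^ 2 * pairing κ ρ ρ := by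
  have key : ∀ {μ ν : Measure X}, memEplus κ μ → memEplus κ ν → ∀ t : ℝ, 0 ≤ t →
      0 ≤ strongDist κ μ ν ^ 2 + 2 * t * (pairing κ μ ρ - pairing κ ν ρ)
        + t ^ 2 * pairing κ ρ ρ := by
    intro μ ν hμ hν t ht
    have htρ := hρ.smul hE hκ (c := ENNReal.ofReal t) (by simp)
    have hs := hμ.add hE hκ htρ
    have h := hE.two_mul_pairing_le hs hν
    have hexp := pairing_combination hE hκ (a := 1) (b := ENNReal.ofReal t) (by simp) (by simp)
      hμ hρ
    rw [one_smul, ENNReal.toReal_ofReal ht, ENNReal.toReal_one] at hexp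
    rw [hexp, pairing_add_left hE hκ hμ htρ hν, pairing_smul_left hE hκ (by simp) hρ hν,
      ENNReal.toReal_ofReal ht, pairing_comm hE hκ hρ hν] at h
    rw [hE.strongDist_sq hμ hν]
    linarith
  have hall : ∀ t : ℝ, 0 ≤ pairing κ ρ ρ * (t * t) +
      (2 * (pairing κ μ ρ - pairing κ ν ρ)) * t + strongDist κ μ ν ^ 2 := by
    intro t
    rcases le_total 0 t with ht | ht
    · linarith [key hμ hν t ht]
    · have h := key hν hμ (-t) (by linarith)
      rw [hE.strongDist_sq hν hμ, pairing_comm hE hκ hν hμ] at h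
      rw [hE.strongDist_sq hμ hν]
      linarith
  have := discrim_le_zero hall
  rw [discrim] at this
  linarith

lemma StrongTendstoSeq.tendsto_pairing (hE : EnergyPrinciple κ) (hκ : IsKernel κ)
    {s : ℕ → Measure X} (hs : ∀ n, memEplus κ (s n)) (hμ : memEplus κ μ)
    (h : StrongTendstoSeq κ s μ) (hρ : memEplus κ ρ) :
    Tendsto (fun n => pairing κ (s n) ρ) atTop (𝓝 (pairing κ μ ρ)) := by
  rw [tendsto_iff_norm_sub_tendsto_zero]
  have h1 : Tendsto (fun n => Real.sqrt (strongDist κ (s n) μ ^ 2 * pairing κ ρ ρ)) atTop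
      (𝓝 (Real.sqrt (0 ^ 2 * pairing κ ρ ρ))) :=
    ((Filter.Tendsto.pow h 2).mul_const _).sqrt
  simp only [ne_eq, OfNat.ofNat_ne_zero, not_false_eq_true, zero_pow, zero_mul,
    Real.sqrt_zero] at h1
  refine squeeze_zero (fun _ => norm_nonneg _) (fun n => ?_) h1
  exact Real.abs_le_sqrt (hE.sq_pairing_sub_le hκ (hs n) hμ hρ)

lemma StrongTendstoSeq.tendsto_pairing_self (hE : EnergyPrinciple κ) (hκ : IsKernel κ)
    {s : ℕ → Measure X} (hs : ∀ n, memEplus κ (s n)) (hμ : memEplus κ μ)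
    (h : StrongTendstoSeq κ s μ) :
    Tendsto (fun n => pairing κ (s n) (s n)) atTop (𝓝 (pairing κ μ μ)) := by
  have h1 : Tendsto (fun n => strongDist κ (s n) μ ^ 2 - pairing κ μ μ
      + 2 * pairing κ (s n) μ) atTop (𝓝 (0 ^ 2 - pairing κ μ μ + 2 * pairing κ μ μ)) :=
    ((Filter.Tendsto.pow h 2).sub_const _).add
      ((h.tendsto_pairing hE hκ hs hμ hμ).const_mul 2)
  convert h1 using 2 with n
  · rw [hE.strongDist_sq (hs n) hμ]
    ring
  · ring

end Energy

section Equilibrium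

variable {X : Type*} [TopologicalSpace X] [MeasurableSpace X] [T2Space X] [BorelSpace X]
  {κ : X → X → ℝ≥0∞} {A : Set X} {μ ν : Measure X}

lemma Concentrated.smul_add {c d : ℝ≥0∞} (hμ : Concentrated μ A) (hν : Concentrated ν A) :
    Concentrated (c • μ + d • ν) A :=
  fun K hK => by simp [hμ K hK, hν K hK]

lemma memBreve.combination (hE : EnergyPrinciple κ) (hκ : IsKernel κ) {a b : ℝ≥0∞}
    (hab : a + b = 1) (hμ : memBreve κ A μ) (hν : memBreve κ A ν) :
    memBreve κ A (a • μ + b • ν) := by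
  have ha : a ≠ ⊤ := ne_top_of_le_ne_top one_ne_top (hab ▸ le_self_add)
  have hb : b ≠ ⊤ := ne_top_of_le_ne_top one_ne_top (hab ▸ le_add_self)
  refine ⟨(hμ.1.smul hE hκ ha).add hE hκ (hν.1.smul hE hκ hb), hμ.2.1.smul_add hν.2.1, ?_⟩
  simp [hμ.2.2, hν.2.2, hab]

lemma memBreve.wcap_le (hμ : memBreve κ A μ) : (wcap κ A).toReal ≤ pairing κ μ μ :=
  ENNReal.toReal_mono hμ.1.2.ne (iInf₂_le μ hμ)

/-- Along an energy-minimising sequence the strong distances tend to zero. -/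
lemma strongCauchySeq_of_minimizing (hE : EnergyPrinciple κ) (hκ : IsKernel κ)
    {s : ℕ → Measure X} (hs : ∀ n, memBreve κ A (s n))
    (hlim : Tendsto (fun n => pairing κ (s n) (s n)) atTop (𝓝 (wcap κ A).toReal)) :
    StrongCauchySeq κ s := by
  intro ε hε
  obtain ⟨N, hN⟩ := eventually_atTop.1
    (hlim.eventually_lt_const (show (wcap κ A).toReal < (wcap κ A).toReal + ε ^ 2 / 4 by
      linarith [pow_pos hε 2]))
  refine ⟨N, fun m hm n hn => ?_⟩
  have hmid := ((hs m).combination hE hκ (a := 2⁻¹) (b := 2⁻¹)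
    (ENNReal.inv_two_add_inv_two) (hs n)).wcap_le
  rw [pairing_combination hE hκ (by simp) (by simp) (hs m).1 (hs n).1] at hmid
  simp only [ENNReal.toReal_inv, ENNReal.toReal_ofNat] at hmid
  refine lt_of_pow_lt_pow_left₀ 2 hε.le ?_
  rw [hE.strongDist_sq (hs m).1 (hs n).1]
  linarith [hN m hm, hN n hn]

/-- A strong limit of an energy-minimising sequence has mutual energy at least `w(A)` with every
competitor. -/
lemma wcap_le_pairing_of_minimizing (hE : EnergyPrinciple κ) (hκ : IsKernel κ)
    {s : ℕ → Measure X} (hs : ∀ n, memBreve κ A (s n))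
    (hlim : Tendsto (fun n => pairing κ (s n) (s n)) atTop (𝓝 (wcap κ A).toReal))
    (hμ : memEplus κ μ) (hsμ : StrongTendstoSeq κ s μ) (hν : memBreve κ A ν) :
    (wcap κ A).toReal ≤ pairing κ μ ν := by
  set w := (wcap κ A).toReal
  have hL := hsμ.tendsto_pairing hE hκ (fun n => (hs n).1) hμ hν.1
  have key : ∀ t : ℝ, 0 < t → t < 1 →
      w * (2 - t) ≤ 2 * (1 - t) * pairing κ μ ν + t * pairing κ ν ν := by
    intro t ht ht1
    have hn : ∀ n, w ≤ (1 - t) ^ 2 * pairing κ (s n) (s n)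
        + 2 * (1 - t) * t * pairing κ (s n) ν + t ^ 2 * pairing κ ν ν := by
      intro n
      have h := ((hs n).combination hE hκ (a := ENNReal.ofReal (1 - t)) (b := ENNReal.ofReal t)
        (by rw [← ENNReal.ofReal_add (by linarith) ht.le]; simp) hν).wcap_le
      rwa [pairing_combination hE hκ (by simp) (by simp) (hs n).1 hν.1,
        ENNReal.toReal_ofReal (by linarith), ENNReal.toReal_ofReal ht.le] at h
    have hle := ge_of_tendsto' (((hlim.const_mul ((1 - t) ^ 2)).add
      (hL.const_mul (2 * (1 - t) * t))).add_const (t ^ 2 * pairing κ ν ν)) hn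
    refine le_of_mul_le_mul_left ?_ ht
    linarith
  have hcont : Tendsto (fun t : ℝ => 2 * (1 - t) * pairing κ μ ν + t * pairing κ ν ν - w * (2 - t))
      (𝓝[>] 0) (𝓝 (2 * (1 - 0) * pairing κ μ ν + 0 * pairing κ ν ν - w * (2 - 0))) := by
    refine Tendsto.mono_left (Continuous.tendsto ?_ 0) nhdsWithin_le_nhds
    fun_prop
  have h := ge_of_tendsto hcont (b := 0) (by
    filter_upwards [Ioo_mem_nhdsGT (show (0 : ℝ) < 1 by norm_num)] with t ht
    exact sub_nonneg.2 (key t ht.1 ht.2))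
  linarith

/-- If `I(μ,ν) ≥ w` for every normalised competitor `ν`, then `U^μ ≥ w` nearly everywhere. -/
lemma le_potential_ae_of_le_pairing (hE : EnergyPrinciple κ) (hκ : IsKernel κ)
    (hμ : memEplus κ μ) {w : ℝ≥0∞} (hw : w ≠ ⊤)
    (h : ∀ ν, memBreve κ A ν → w.toReal ≤ pairing κ μ ν)
    (hν : memEplus κ ν) (hνA : Concentrated ν A) : ∀ᵐ x ∂ν, w ≤ potential κ μ x := by
  have hm := hμ.measurable_potential hκ
  by_contra hne
  have hB : MeasurableSet {x | w ≤ potential κ μ x}ᶜ := (measurableSet_le measurable_const hm).compl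
  obtain ⟨ρ, hρ, hρ1, hρν, hρB⟩ := hν.exists_normalized_restrict hE hκ hB hne
  have := hν.sigmaFinite hE hκ
  have : ν.Regular := hν.1
  have hρA : memBreve κ A ρ := ⟨hρ, concentrated_of_ae (hρν hνA.ae_mem), hρ1⟩
  have hfin := hE.mutualEnergy_ne_top hμ hρ
  have hle : w ≤ mutualEnergy κ μ ρ := (ENNReal.toReal_le_toReal hw hfin).1 (h ρ hρA)
  rw [hμ.mutualEnergy_comm hE hκ hρ, hρ.mutualEnergy_eq hE hκ hμ] at hle
  have hlt : ∫⁻ x, potential κ μ x ∂ρ < ∫⁻ _, w ∂ρ := by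
    refine lintegral_strict_mono (fun h0 => by simp [h0] at hρ1) aemeasurable_const ?_ ?_
    · rw [← hρ.mutualEnergy_eq hE hκ hμ]
      exact hE.mutualEnergy_ne_top hρ hμ
    · filter_upwards [hρB] with x hx using not_le.1 hx
  rw [lintegral_const, hρ1, mul_one] at hlt
  exact absurd hle hlt.not_ge

/-- Open sets whose masses tend to zero along a vaguely convergent sequence are null in the
limit. -/
lemma VagueTendstoSeq.measure_eq_zero [LocallyCompactSpace X] {s : ℕ → Measure X} [μ.Regular]
    (h : VagueTendstoSeq s μ) (hfin : ∀ n, IsFiniteMeasure (s n)) {G : Set X} (hG : IsOpen G)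
    (hlim : Tendsto (fun n => (s n).real G) atTop (𝓝 0)) : μ G = 0 := by
  rw [hG.measure_eq_iSup_isCompact]
  simp only [ENNReal.iSup_eq_zero]
  intro K hKG hK
  obtain ⟨φ, hφ1, hφ0, hφc, hφ⟩ := exists_continuous_one_zero_of_isCompact hK
    hG.isClosed_compl (disjoint_compl_right_iff_subset.2 hKG)
  have hint : ∀ (m : Measure X) [IsFiniteMeasureOnCompacts m], Integrable φ m :=
    fun m _ => φ.continuous.integrable_of_hasCompactSupport hφc
  have hle : ∀ n, ∫ x, φ x ∂(s n) ≤ (s n).real G := by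
    intro n
    rw [← integral_indicator_one hG.measurableSet]
    refine integral_mono (hint _) ((integrable_const _).indicator hG.measurableSet) fun x => ?_
    by_cases hx : x ∈ G
    · simpa [indicator_of_mem hx] using (hφ x).2
    · simpa [indicator_of_notMem hx] using (hφ0 hx).le
  have h0 : ∫ x, φ x ∂μ ≤ 0 := le_of_tendsto_of_tendsto' (h φ φ.continuous hφc) hlim hle
  have hKμ : μ.real K ≤ ∫ x, φ x ∂μ := by
    rw [← integral_indicator_one hK.measurableSet]
    refine integral_mono ((integrable_indicator_iff hK.measurableSet).2
      (integrableOn_const hK.measure_lt_top.ne)) (hint μ) fun x => ?_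
    by_cases hx : x ∈ K
    · simpa [indicator_of_mem hx] using (hφ1 hx).ge
    · simpa [indicator_of_notMem hx] using (hφ x).1
  have hK0 : μ.real K = 0 := le_antisymm (hKμ.trans h0) measureReal_nonneg
  exact (measureReal_eq_zero_iff hK.measure_lt_top.ne).1 hK0

/-- The potential of the strong limit of an energy-minimising sequence is at most `w(A)` almost
everywhere. -/
lemma potential_le_ae_of_minimizing [LocallyCompactSpace X] (hE : EnergyPrinciple κ)
    (hκ : IsKernel κ) {s : ℕ → Measure X} (hs : ∀ n, memBreve κ A (s n))
    (hμ : memEplus κ μ) {w : ℝ≥0∞} (hw : w ≠ ⊤)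
    (hlim : Tendsto (fun n => pairing κ μ (s n)) atTop (𝓝 w.toReal))
    (hvague : VagueTendstoSeq s μ)
    (hge : ∀ n, ∀ᵐ x ∂(s n), w ≤ potential κ μ x) :
    ∀ᵐ x ∂μ, potential κ μ x ≤ w := by
  have : μ.Regular := hμ.1
  have hm := hμ.measurable_potential hκ
  have hfin : ∀ n, IsFiniteMeasure (s n) := fun n => ⟨by simp [(hs n).2.2]⟩
  have hlevel : ∀ ε : ℝ, 0 < ε → μ {x | w + ENNReal.ofReal ε < potential κ μ x} = 0 := by
    intro ε hε
    have hopen : IsOpen {x | w + ENNReal.ofReal ε < potential κ μ x} :=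
      (lowerSemicontinuous_potential hκ μ).isOpen_preimage _
    refine hvague.measure_eq_zero hfin hopen ?_
    have hbound : ∀ n, (s n).real {x | w + ENNReal.ofReal ε < potential κ μ x}
        ≤ ε⁻¹ * (pairing κ μ (s n) - w.toReal) := by
      intro n
      set G := {x | w + ENNReal.ofReal ε < potential κ μ x}
      have h1 : w + ENNReal.ofReal ε * (s n) G ≤ mutualEnergy κ μ (s n) := by
        rw [hμ.mutualEnergy_comm hE hκ (hs n).1, (hs n).1.mutualEnergy_eq hE hκ hμ]
        calc w + ENNReal.ofReal ε * (s n) G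
            = ∫⁻ x, (w + G.indicator (fun _ => ENNReal.ofReal ε) x) ∂(s n) := by
              rw [lintegral_add_left measurable_const, lintegral_const, (hs n).2.2, mul_one,
                lintegral_indicator_const hopen.measurableSet]
          _ ≤ ∫⁻ x, potential κ μ x ∂(s n) := by
              refine lintegral_mono_ae ?_
              filter_upwards [hge n] with x hx
              by_cases hxG : x ∈ G
              · rw [indicator_of_mem hxG]
                exact hxG.le
              · rwa [indicator_of_notMem hxG, add_zero]
      have h2 := ENNReal.toReal_mono (hE.mutualEnergy_ne_top hμ (hs n).1) h1
      rw [ENNReal.toReal_add hw (by finiteness), ENNReal.toReal_mul,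
        ENNReal.toReal_ofReal hε.le] at h2
      rw [le_inv_mul_iff₀ hε]
      change ε * ((s n) G).toReal ≤ pairing κ μ (s n) - w.toReal
      rw [pairing]
      linarith
    refine squeeze_zero (fun n => measureReal_nonneg) hbound ?_
    simpa using (hlim.sub_const w.toReal).const_mul ε⁻¹
  have hall : ∀ᵐ x ∂μ, ∀ n : ℕ, potential κ μ x ≤ w + ENNReal.ofReal (1 / ((n : ℝ) + 1)) := by
    rw [ae_all_iff]
    intro n
    have h := hlevel (1 / ((n : ℝ) + 1)) (by positivity)
    rw [ae_iff]
    simpa only [not_le] using h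
  filter_upwards [hall] with x hx
  have hlim0 : Tendsto (fun n : ℕ => w + ENNReal.ofReal (1 / ((n : ℝ) + 1))) atTop
      (𝓝 (w + ENNReal.ofReal 0)) :=
    (ENNReal.tendsto_ofReal tendsto_one_div_add_atTop_nhds_zero_nat).const_add w
  rw [ENNReal.ofReal_zero, add_zero] at hlim0
  exact ge_of_tendsto' hlim0 hx

/-- Frostman's maximum principle for an arbitrary bound that holds almost everywhere. -/
lemma FrostmanMax.potential_le (hfr : FrostmanMax κ) (hE : EnergyPrinciple κ) (hκ : IsKernel κ)
    (hμ : memEplus κ μ) {w : ℝ≥0∞} (hw0 : w ≠ 0) (hw : w ≠ ⊤)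
    (h : ∀ᵐ x ∂μ, potential κ μ x ≤ w) (x : X) : potential κ μ x ≤ w := by
  have : μ.Regular := hμ.1
  have hopen : IsOpen {x | w < potential κ μ x} :=
    (lowerSemicontinuous_potential hκ μ).isOpen_preimage _
  have hscale : ∀ y, potential κ (w⁻¹ • μ) y ≤ 1 ↔ potential κ μ y ≤ w := by
    intro y
    rw [potential_smul, ENNReal.inv_mul_le_iff hw0 hw, mul_one]
  have hmax := hfr (w⁻¹ • μ) (hμ.smul hE hκ (by simpa using hw0)) ?_ x
  · exact (hscale x).1 hmax
  · intro y hy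
    rw [hscale]
    by_contra hlt
    have hpos := hy _ hopen (not_le.1 hlt)
    have hnull : μ {x | w < potential κ μ x} = 0 := by
      simpa only [not_le] using ae_iff.1 h
    simp [hnull] at hpos

/-- Existence of the inner equilibrium measure: a unit measure on `A` whose potential equals
`w(A)` nearly everywhere on `A` and does not exceed it anywhere. -/
lemma exists_equilibrium [LocallyCompactSpace X] (hκ : IsKernel κ) (hperf : IsPerfect κ)
    (hfr : FrostmanMax κ) (hclosed : StrongClosedEplusOn κ A)
    (hw0 : wcap κ A ≠ 0) (hw : wcap κ A ≠ ⊤) :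
    ∃ μ, memBreve κ A μ ∧ (∀ x, potential κ μ x ≤ wcap κ A) ∧
      ∀ ν, memEplus κ ν → Concentrated ν A → ∀ᵐ x ∂ν, potential κ μ x = wcap κ A := by
  obtain ⟨hE, hcomplete, hvague⟩ := hperf
  have hex : ∀ n : ℕ, ∃ μ, memBreve κ A μ ∧
      pairing κ μ μ < (wcap κ A).toReal + 1 / ((n : ℝ) + 1) := by
    intro n
    have hpos : (0 : ℝ) < 1 / ((n : ℝ) + 1) := by positivity
    have hlt : wcap κ A < wcap κ A + ENNReal.ofReal (1 / ((n : ℝ) + 1)) :=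
      ENNReal.lt_add_right hw (by simpa using hpos)
    obtain ⟨μ, hμ'⟩ := iInf_lt_iff.1 hlt
    obtain ⟨hμ, hμlt⟩ := iInf_lt_iff.1 hμ'
    refine ⟨μ, hμ, ?_⟩
    have := ENNReal.toReal_strict_mono (by finiteness) hμlt
    rwa [ENNReal.toReal_add hw (by simp), ENNReal.toReal_ofReal hpos.le] at this
  choose s hs hslt using hex
  have hlim : Tendsto (fun n => pairing κ (s n) (s n)) atTop (𝓝 (wcap κ A).toReal) := by
    refine tendsto_of_tendsto_of_tendsto_of_le_of_le tendsto_const_nhds ?_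
      (fun n => (hs n).wcap_le) (fun n => (hslt n).le)
    simpa using tendsto_one_div_add_atTop_nhds_zero_nat.const_add (wcap κ A).toReal
  obtain ⟨μ, hμ, hsμ⟩ := hcomplete s (fun n => (hs n).1)
    (strongCauchySeq_of_minimizing hE hκ hs hlim)
  have hμA : Concentrated μ A := hclosed s μ (fun n => ⟨(hs n).1, (hs n).2.1⟩) hμ hsμ
  have hself : pairing κ μ μ = (wcap κ A).toReal :=
    tendsto_nhds_unique (hsμ.tendsto_pairing_self hE hκ (fun n => (hs n).1) hμ) hlim
  have hge : ∀ ν, memEplus κ ν → Concentrated ν A → ∀ᵐ x ∂ν, wcap κ A ≤ potential κ μ x :=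
    fun ν hν hνA => le_potential_ae_of_le_pairing hE hκ hμ hw
      (fun ν hν => wcap_le_pairing_of_minimizing hE hκ hs hlim hμ hsμ hν) hν hνA
  have hmix : Tendsto (fun n => pairing κ μ (s n)) atTop (𝓝 (wcap κ A).toReal) := by
    rw [← hself]
    refine (hsμ.tendsto_pairing hE hκ (fun n => (hs n).1) hμ hμ).congr fun n => ?_
    exact pairing_comm hE hκ (hs n).1 hμ
  have hle : ∀ x, potential κ μ x ≤ wcap κ A :=
    hfr.potential_le hE hκ hμ hw0 hw
      (potential_le_ae_of_minimizing hE hκ hs hμ hw hmix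
        (hvague s μ (fun n => (hs n).1) hμ hsμ) fun n => hge _ (hs n).1 (hs n).2.1)
  have heq : ∀ ν, memEplus κ ν → Concentrated ν A → ∀ᵐ x ∂ν, potential κ μ x = wcap κ A := by
    intro ν hν hνA
    filter_upwards [hge ν hν hνA] with x hx using le_antisymm (hle x) hx
  refine ⟨μ, ⟨hμ, hμA, ?_⟩, hle, heq⟩
  have hen : energy κ μ = wcap κ A :=
    (ENNReal.toReal_eq_toReal_iff' hμ.2.ne hw).1 hself
  rw [energy, hμ.mutualEnergy_eq hE hκ hμ, lintegral_congr_ae (heq μ hμ hμA),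
    lintegral_const] at hen
  exact (ENNReal.mul_eq_left hw0 hw).1 hen

end Equilibrium

section Gauss

variable {X : Type*} [TopologicalSpace X] [MeasurableSpace X] [T2Space X] [BorelSpace X]
  {κ : X → X → ℝ≥0∞} {A : Set X} {μ ν ζ l : Measure X} {f : X → EReal}

lemma memEplus.potential_lt_top_ae (hE : EnergyPrinciple κ) (hκ : IsKernel κ)
    (hμ : memEplus κ μ) (hν : memEplus κ ν) : ∀ᵐ x ∂ν, potential κ μ x < ⊤ :=
  ae_lt_top (hμ.measurable_potential hκ) (by
    rw [← hν.mutualEnergy_eq hE hκ hμ]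
    exact hE.mutualEnergy_ne_top hν hμ)

lemma IsInnerBalayage.potential_ae_eq {β : Measure X} (hE : EnergyPrinciple κ)
    (hκ : IsKernel κ) (hζ : memEplus κ ζ) (hβ : IsInnerBalayage κ A ζ β)
    (hν : memEplus κ ν) (hνA : Concentrated ν A) :
    ∀ᵐ x ∂ν, potential κ β x = potential κ ζ x :=
  hβ.2.2.ae hE hκ
    (measurableSet_eq_fun (hβ.1.measurable_potential hκ) (hζ.measurable_potential hκ)) hν hνA

/-- A unit measure on `A` whose potential exceeds `U^ζ` by the constant `(1 − ζ^A(X))/cap_*(A)`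
nearly everywhere on `A`. -/
lemma exists_weighted_equilibrium [LocallyCompactSpace X] {β : Measure X} (hκ : IsKernel κ)
    (hperf : IsPerfect κ) (hfr : FrostmanMax κ) (hclosed : StrongClosedEplusOn κ A)
    (hcap0 : innerCap κ A ≠ 0) (hζ : memEplus κ ζ) (hζ1 : ζ univ ≤ 1)
    (hβ : IsInnerBalayage κ A ζ β) (hex : innerCap κ A ≠ ⊤ ∨ β univ = 1) :
    ∃ μ, memBreve κ A μ ∧ ∀ ν, memEplus κ ν → Concentrated ν A →
      ∀ᵐ x ∂ν, potential κ μ x = potential κ ζ x + (1 - β univ) / innerCap κ A := by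
  have hE := hperf.1
  by_cases hb : β univ = 1
  · refine ⟨β, ⟨hβ.1, hβ.2.1, hb⟩, fun ν hν hνA => ?_⟩
    filter_upwards [hβ.potential_ae_eq hE hκ hζ hν hνA] with x hx
    simp [hx, hb]
  have hw0 : wcap κ A ≠ 0 := by
    have := hex.resolve_right hb
    rwa [innerCap, ne_eq, ENNReal.inv_eq_top] at this
  have hw : wcap κ A ≠ ⊤ := by
    rwa [innerCap, ne_eq, ENNReal.inv_eq_zero] at hcap0
  obtain ⟨γ, hγ, hγle, hγeq⟩ := exists_equilibrium hκ hperf hfr hclosed hw0 hw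
  have hb1 : β univ ≤ 1 := by
    have h : wcap κ A * β univ ≤ wcap κ A * 1 := calc
      wcap κ A * β univ = ∫⁻ x, potential κ γ x ∂β := by
        rw [lintegral_congr_ae (hγeq β hβ.1 hβ.2.1), lintegral_const]
      _ = ∫⁻ x, potential κ β x ∂γ := by
        rw [← hβ.1.mutualEnergy_eq hE hκ hγ.1, hβ.1.mutualEnergy_comm hE hκ hγ.1,
          hγ.1.mutualEnergy_eq hE hκ hβ.1]
      _ = ∫⁻ x, potential κ γ x ∂ζ := by
        rw [lintegral_congr_ae (hβ.potential_ae_eq hE hκ hζ hγ.1 hγ.2.1),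
          ← hγ.1.mutualEnergy_eq hE hκ hζ, hγ.1.mutualEnergy_comm hE hκ hζ,
          hζ.mutualEnergy_eq hE hκ hγ.1]
      _ ≤ ∫⁻ _, wcap κ A ∂ζ := lintegral_mono hγle
      _ ≤ wcap κ A * 1 := by
        rw [lintegral_const]
        gcongr
    exact (ENNReal.mul_le_mul_iff_right hw0 hw).1 h
  have hc : 1 - β univ ≠ ⊤ := by finiteness
  refine ⟨β + (1 - β univ) • γ, ⟨hβ.1.add hE hκ (hγ.1.smul hE hκ hc), ?_, ?_⟩, ?_⟩
  · simpa using hβ.2.1.smul_add (c := 1) (d := 1 - β univ) hγ.2.1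
  · simp [hγ.2.2, add_tsub_cancel_of_le hb1]
  · intro ν hν hνA
    filter_upwards [hβ.potential_ae_eq hE hκ hζ hν hνA, hγeq ν hν hνA] with x hx hx'
    rw [potential_add, potential_smul, hx, hx', innerCap, div_eq_mul_inv, inv_inv]

lemma fieldIntegrable_neg_potential (hE : EnergyPrinciple κ) (hκ : IsKernel κ)
    (hζ : memEplus κ ζ) (hf : ∀ x, f x = -(potential κ ζ x : EReal)) (hν : memEplus κ ν) :
    FieldIntegrable f ν := by
  constructor
  · simp only [hf, EReal.toReal_neg_eq, EReal.toReal_coe_ennreal]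
    refine (integrable_toReal_of_lintegral_ne_top
      (hζ.measurable_potential hκ).aemeasurable ?_).neg
    rw [← hν.mutualEnergy_eq hE hκ hζ]
    exact hE.mutualEnergy_ne_top hν hζ
  · filter_upwards [hζ.potential_lt_top_ae hE hκ hν] with x hx
    lift potential κ ζ x to NNReal using hx.ne with a ha
    rw [hf, ← ha]
    exact ⟨by simp [EReal.neg_eq_top_iff], by simp [EReal.neg_eq_bot_iff]⟩

lemma gaussI_neg_potential (hE : EnergyPrinciple κ) (hκ : IsKernel κ)
    (hζ : memEplus κ ζ) (hf : ∀ x, f x = -(potential κ ζ x : EReal)) (hν : memEplus κ ν) :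
    gaussI κ f ν = pairing κ ν ν - 2 * pairing κ ν ζ := by
  have h : fieldIntegral f ν = -pairing κ ν ζ := by
    rw [fieldIntegral, pairing, hν.mutualEnergy_eq hE hκ hζ,
      ← integral_toReal (hζ.measurable_potential hκ).aemeasurable
        (hζ.potential_lt_top_ae hE hκ hν), ← integral_neg]
    simp only [hf, EReal.toReal_neg_eq, EReal.toReal_coe_ennreal]
  rw [gaussI, h]
  change pairing κ ν ν + _ = _
  ring

/-- A unit measure on `A` whose potential differs from `U^ζ` by a constant nearly everywhere on
`A` is the only candidate for a solution of the Gauss problem with field `−U^ζ`. -/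
lemma IsSolution.eq_of_potential_ae_eq (hE : EnergyPrinciple κ) (hκ : IsKernel κ)
    (hζ : memEplus κ ζ) (hf : ∀ x, f x = -(potential κ ζ x : EReal)) {c : ℝ≥0∞} (hc : c ≠ ⊤)
    (hl : IsSolution κ A f l) (hμ : memBreve κ A μ)
    (h : ∀ ν, memEplus κ ν → Concentrated ν A →
      ∀ᵐ x ∂ν, potential κ μ x = potential κ ζ x + c) : μ = l := by
  have hp : ∀ ν, memBreve κ A ν → pairing κ ν μ = pairing κ ν ζ + c.toReal := by
    intro ν hν
    have hm : mutualEnergy κ ν μ = mutualEnergy κ ν ζ + c := by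
      rw [hν.1.mutualEnergy_eq hE hκ hμ.1, hν.1.mutualEnergy_eq hE hκ hζ,
        lintegral_congr_ae (h ν hν.1 hν.2.1), lintegral_add_right _ measurable_const,
        lintegral_const, hν.2.2, mul_one]
    rw [pairing, hm, ENNReal.toReal_add (hE.mutualEnergy_ne_top hν.1 hζ) hc, pairing]
  have hle : gaussI κ f l ≤ gaussI κ f μ := by
    rw [← EReal.coe_le_coe_iff, hl.2]
    exact iInf₂_le μ ⟨hμ, fieldIntegrable_neg_potential hE hκ hζ hf hμ.1⟩
  rw [gaussI_neg_potential hE hκ hζ hf hl.1.1.1, gaussI_neg_potential hE hκ hζ hf hμ.1] at hle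
  refine hE.eq_of_le_two_mul_pairing hμ.1 hl.1.1.1 ?_
  linarith [hp μ hμ, hp l hl.1.1, pairing_comm hE hκ hμ.1 hl.1.1.1]

lemma le_wPotential_iff (hf : ∀ x, f x = -(potential κ ζ x : EReal)) (c : ℝ≥0∞) (x : X) :
    (c : EReal) ≤ wPotential κ f μ x ↔
      potential κ ζ x ≠ ⊤ ∧ potential κ ζ x + c ≤ potential κ μ x := by
  rw [wPotential, hf]
  by_cases h : potential κ ζ x = ⊤
  · simp [h]
  · rw [← sub_eq_add_neg, EReal.le_sub_iff_add_le (by simp) (by simp [h]), add_comm,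
      ← EReal.coe_ennreal_add, EReal.coe_ennreal_le_coe_ennreal_iff]
    simp [h]

lemma measurableSet_le_wPotential (hκ : IsKernel κ) (hζ : memEplus κ ζ)
    (hf : ∀ x, f x = -(potential κ ζ x : EReal)) (hμ : memEplus κ μ) (c : ℝ≥0∞) :
    MeasurableSet {x | (c : EReal) ≤ wPotential κ f μ x} := by
  have hm := hζ.measurable_potential hκ
  simp only [le_wPotential_iff hf]
  exact (hm (measurableSet_singleton ⊤)).compl.inter
    (measurableSet_le (hm.add_const c) (hμ.measurable_potential hκ))

lemma EnergyPrinciple.eq_of_potential_eq (hE : EnergyPrinciple κ) (hκ : IsKernel κ)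
    (hμ : memEplus κ μ) (hν : memEplus κ ν) (h : ∀ x, potential κ μ x = potential κ ν x) :
    μ = ν := by
  have hp : ∀ ρ, memEplus κ ρ → pairing κ ρ μ = pairing κ ρ ν := fun ρ hρ => by
    rw [pairing, pairing, hρ.mutualEnergy_eq hE hκ hμ, hρ.mutualEnergy_eq hE hκ hν,
      lintegral_congr h]
  refine hE.eq_of_le_two_mul_pairing hμ hν ?_
  linarith [hp μ hμ, hp ν hν, pairing_comm hE hκ hμ hν]

end Gauss

theorem stmt6 {X : Type*} [TopologicalSpace X] [T2Space X] [LocallyCompactSpace X]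
    [MeasurableSpace X] [BorelSpace X]
    (κ : X → X → ℝ≥0∞) (A : Set X) (ζ β : Measure X) (f : X → EReal)
    (hker : IsKernel κ) (hperf : IsPerfect κ)
    (hfr : FrostmanMax κ) (hdom : DominationPrinciple κ)
    (hcap0 : innerCap κ A ≠ 0) (hclosed : StrongClosedEplusOn κ A)
    (hζ : memEplus κ ζ) (hζ1 : ζ Set.univ ≤ 1)
    (hf : ∀ x, f x = -((potential κ ζ x : ℝ≥0∞) : EReal))
    (hβ : IsInnerBalayage κ A ζ β)
    (hex : innerCap κ A ≠ ⊤ ∨ β Set.univ = 1)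
    (l : Measure X) (hl : IsSolution κ A f l) :
    -- `l ∈ Λ_{A,f}`, with `η := (1 − ζ^A(X))/cap_*(A)`
    (memEplus κ l ∧ NearlyEverywhere κ A
      (fun x => ((((1 : ℝ≥0∞) - β Set.univ) / innerCap κ A : ℝ≥0∞) : EReal)
        ≤ wPotential κ f l x)) ∧
    -- `l` has minimum potential in `Λ_{A,f}`
    (∀ μ : Measure X, memEplus κ μ →
      NearlyEverywhere κ A
        (fun x => ((((1 : ℝ≥0∞) - β Set.univ) / innerCap κ A : ℝ≥0∞) : EReal)
          ≤ wPotential κ f μ x) →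
      ∀ x : X, potential κ l x ≤ potential κ μ x) ∧
    -- and `l` is the unique element of `Λ_{A,f}` with this property
    (∀ μ : Measure X, memEplus κ μ →
      NearlyEverywhere κ A
        (fun x => ((((1 : ℝ≥0∞) - β Set.univ) / innerCap κ A : ℝ≥0∞) : EReal)
          ≤ wPotential κ f μ x) →
      (∀ ν : Measure X, memEplus κ ν →
        NearlyEverywhere κ A
          (fun x => ((((1 : ℝ≥0∞) - β Set.univ) / innerCap κ A : ℝ≥0∞) : EReal)
            ≤ wPotential κ f ν x) →
        ∀ x : X, potential κ μ x ≤ potential κ ν x) →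
      μ = l) := by
  have hE := hperf.1
  have hη : (1 - β univ) / innerCap κ A ≠ ⊤ := ENNReal.div_ne_top (by finiteness) hcap0
  set η := (1 - β univ) / innerCap κ A
  obtain ⟨σ, hσ, hση⟩ :=
    exists_weighted_equilibrium hker hperf hfr hclosed hcap0 hζ hζ1 hβ hex
  obtain rfl := hl.eq_of_potential_ae_eq hE hker hζ hf hη hσ hση
  have hmem : NearlyEverywhere κ A (fun x => (η : EReal) ≤ wPotential κ f σ x) := by
    refine nearlyEverywhere_of_ae hE hker fun ν hν hνA => ?_
    filter_upwards [hση ν hν hνA, hζ.potential_lt_top_ae hE hker hν] with x hx hx'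
    exact (le_wPotential_iff hf η x).2 ⟨hx'.ne, hx.ge⟩
  have hmin : ∀ μ : Measure X, memEplus κ μ →
      NearlyEverywhere κ A (fun x => (η : EReal) ≤ wPotential κ f μ x) →
      ∀ x : X, potential κ σ x ≤ potential κ μ x := by
    intro μ hμ hne
    refine hdom σ μ hσ.1 hμ ?_
    filter_upwards [hση σ hσ.1 hσ.2.1,
      hne.ae hE hker (measurableSet_le_wPotential hker hζ hf hμ η) hσ.1 hσ.2.1] with x hx hx'
    exact hx.le.trans ((le_wPotential_iff hf η x).1 hx').2
  exact ⟨⟨hσ.1, hmem⟩, hmin, fun μ hμ hne hμmin =>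
    hE.eq_of_potential_eq hker hμ hσ.1 fun x =>
      le_antisymm (hμmin σ hσ.1 hmem x) (hmin μ hμ hne x)⟩

end GaussVar
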